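/- For the filiform Lie superalgebra F_{2,2}^4 over an algebraically closed field of characteristic zero, the Betti numbers of cohomology with trivial coefficients are dim H^0 = 1, dim H^1 = 3, dim H^2 = 6, and dim H^k = 8 for all k ≥ 3. -/

import Mathlib

open scoped Classical
open Finset

noncomputable section

namespace SuperCE

variable (F : Type*) [Field F] {B : Type*} [Fintype B] [DecidableEq B]

/-- Cochains of the super Chevalley–Eilenberg complex with trivial coefficients:
finitely supported families of coefficients indexed by exponent vectors of monomials in
the dual generators (exterior in duals of even basis vectors, polynomial in duals of odd
basis vectors). -/
abbrev Cochain (F : Type*) [Field F] (B : Type*) := (B → ℕ) →₀ F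

variable (p ord : B → ℕ) (c : B → B → B → F)

/-- exponent vector of a single dual generator -/
def eps (b : B) : B → ℕ := fun x => if x = b then 1 else 0

/-- cohomological (`ℤ`-) degree of a monomial -/
def deg (μ : B → ℕ) : ℕ := ∑ b, μ b

/-- admissible exponent vectors: duals of even basis vectors are exterior generators -/
def IsAdm (μ : B → ℕ) : Prop := ∀ b, p b = 0 → μ b ≤ 1

/-- Koszul sign for multiplying the ordered monomial with exponent vector `μ` by the one
with exponent vector `ν`: two dual generators supercommute, i.e. anticommute except that a
pair of generators dual to odd basis vectors commutes. -/
def sgnProd (μ ν : B → ℕ) : F :=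
  (-1 : F) ^ (∑ b1, ∑ b2, if ord b2 < ord b1 then μ b1 * ν b2 * (1 + p b1 * p b2) else 0)

/-- the supercommutative product of cochains (wedge/polynomial multiplication) -/
def Pmul (f g : Cochain F B) : Cochain F B :=
  f.sum fun μ a => g.sum fun ν b' =>
    if IsAdm p (fun x => μ x + ν x) then
      Finsupp.single (fun x => μ x + ν x) (a * b' * sgnProd F p ord μ ν)
    else 0

/-- coefficients of the differential on a dual generator `x_b*`, namely
`d(x_b*) = ∑_{k<l} (-1)^{|x_k||x_l|} c k l b x_k* x_l* - (1/2) ∑_{k odd} c k k b x_k*²`,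
where `c k l b` is the structure constant of the Lie superalgebra. -/
def dcoef (b k l : B) : F :=
  if ord k < ord l then (-1 : F) ^ (p k * p l) * c k l b
  else if k = l ∧ p k = 1 then -((2 : F)⁻¹) * c k k b
  else 0

/-- target exponent vector obtained from `μ` by differentiating the generator `b`
into the pair `(k, l)` -/
def tgt (μ : B → ℕ) (b k l : B) : B → ℕ :=
  fun x => μ x - eps b x + eps k x + eps l x

/-- the Chevalley–Eilenberg differential of a single monomial, obtained by extending `d`
on generators as a `ℤ`-degree `+1`, parity-even superderivation (Koszul signs included) -/
def dMono (μ : B → ℕ) : Cochain F B :=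
  ∑ b, ∑ k, ∑ l,
    if μ b ≠ 0 ∧ IsAdm p (tgt μ b k l) then
      Finsupp.single (tgt μ b k l)
        (((-1 : F) ^ (∑ b', if ord b' < ord b then μ b' else 0)) *
         (μ b : F) * ((-1 : F) ^ ((μ b - 1) * p b)) *
         ((-1 : F) ^ (p b * ∑ b'', if ord b < ord b'' then μ b'' * p b'' else 0)) *
         dcoef F p ord c b k l *
         sgnProd F p ord (fun x => μ x - eps b x) (fun x => eps k x + eps l x))
    else 0

/-- the Chevalley–Eilenberg differential with trivial coefficients -/
def d : Cochain F B →ₗ[F] Cochain F B :=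
  Finsupp.lsum F fun μ => LinearMap.toSpanSingleton F (Cochain F B) (dMono F p ord c μ)

/-- cochains supported on admissible monomials of cohomological degree `k`,
i.e. the `k`-th term `Λᵏ g*` of the super Chevalley–Eilenberg complex -/
def AdmDeg (k : ℕ) : Submodule F (Cochain F B) where
  carrier := {f | ∀ μ, f μ ≠ 0 → IsAdm p μ ∧ deg μ = k}
  add_mem' := by
    intro f g hf hg μ hμ
    by_cases h1 : f μ = 0
    · exact hg μ (by simpa [Finsupp.add_apply, h1] using hμ)
    · exact hf μ h1
  zero_mem' := by intro μ hμ; simp at hμ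
  smul_mem' := by
    intro a f hf μ hμ
    exact hf μ (fun h0 => hμ (by simp [Finsupp.smul_apply, h0]))

/-- cochains supported on admissible monomials (of any degree), i.e. `Λ• g*` -/
def AdmAll : Submodule F (Cochain F B) where
  carrier := {f | ∀ μ, f μ ≠ 0 → IsAdm p μ}
  add_mem' := by
    intro f g hf hg μ hμ
    by_cases h1 : f μ = 0
    · exact hg μ (by simpa [Finsupp.add_apply, h1] using hμ)
    · exact hf μ h1
  zero_mem' := by intro μ hμ; simp at hμ
  smul_mem' := by
    intro a f hf μ hμ
    exact hf μ (fun h0 => hμ (by simp [Finsupp.smul_apply, h0]))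

/-- degree-`k` cocycles -/
def Zk (k : ℕ) : Submodule F (Cochain F B) :=
  AdmDeg F p k ⊓ LinearMap.ker (d F p ord c)

/-- degree-`k` coboundaries -/
def Bk (k : ℕ) : Submodule F (Cochain F B) :=
  Submodule.map (d F p ord c) (AdmDeg F p (k - 1))

/-- the dimension (Betti number) of the `k`-th Lie superalgebra cohomology
`H^k = Z^k / B^k` with trivial coefficients -/
def Hdim (k : ℕ) : ℕ :=
  Module.finrank F ↥(Zk F p ord c k) -
    Module.finrank F ↥(Bk F p ord c k ⊓ Zk F p ord c k)

end SuperCE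

end

noncomputable section
namespace Paper
open SuperCE

/-- parity of the basis (evens then odds) -/
def pF224 : Fin 3 ⊕ Fin 2 → ℕ := Sum.elim (fun _ => 0) (fun _ => 1)

/-- ordering of the basis -/
def ordF224 : Fin 3 ⊕ Fin 2 → ℕ :=
  Sum.elim (fun i => (i : ℕ)) (fun j => 3 + (j : ℕ))

/-- structure constants -/
def cF224 (F : Type*) [Field F] :
    (Fin 3 ⊕ Fin 2) → (Fin 3 ⊕ Fin 2) → (Fin 3 ⊕ Fin 2) → F :=
  fun a b t =>
    if a = Sum.inl (0 : Fin 3) ∧ b = Sum.inl (1 : Fin 3) ∧ t = Sum.inl (2 : Fin 3) then 1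
    else if a = Sum.inl (1 : Fin 3) ∧ b = Sum.inl (0 : Fin 3) ∧ t = Sum.inl (2 : Fin 3) then -1
    else    if a = Sum.inl (0 : Fin 3) ∧ b = Sum.inr (0 : Fin 2) ∧ t = Sum.inr (1 : Fin 2) then 1
    else if a = Sum.inr (0 : Fin 2) ∧ b = Sum.inl (0 : Fin 3) ∧ t = Sum.inr (1 : Fin 2) then -1
    else    if a = Sum.inl (1 : Fin 3) ∧ b = Sum.inr (0 : Fin 2) ∧ t = Sum.inr (1 : Fin 2) then 1
    else if a = Sum.inr (0 : Fin 2) ∧ b = Sum.inl (1 : Fin 3) ∧ t = Sum.inr (1 : Fin 2) then -1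
    else 0

end Paper
end

noncomputable section
namespace Paper
open SuperCE

/-- The exponent vector of `x₀ᵃ x₁ᵇ x₂ᶜ y₁ᵐ y₂ⁿ`. -/
def mono (a b c m n : ℕ) : Fin 3 ⊕ Fin 2 → ℕ := Sum.elim ![a, b, c] ![m, n]

lemma eq_mono (μ : Fin 3 ⊕ Fin 2 → ℕ) :
    μ = mono (μ (Sum.inl 0)) (μ (Sum.inl 1)) (μ (Sum.inl 2)) (μ (Sum.inr 0)) (μ (Sum.inr 1)) := by
  ext x
  rcases x with i | i <;> fin_cases i <;> rfl

lemma mono_apply (a b c m n : ℕ) :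
    mono a b c m n (Sum.inl 0) = a ∧ mono a b c m n (Sum.inl 1) = b ∧
    mono a b c m n (Sum.inl 2) = c ∧ mono a b c m n (Sum.inr 0) = m ∧
    mono a b c m n (Sum.inr 1) = n := ⟨rfl, rfl, rfl, rfl, rfl⟩

lemma mono_inj {a b c m n a' b' c' m' n' : ℕ} :
    mono a b c m n = mono a' b' c' m' n' ↔ a = a' ∧ b = b' ∧ c = c' ∧ m = m' ∧ n = n' := by
  constructor
  · intro h
    exact ⟨congrFun h (Sum.inl 0), congrFun h (Sum.inl 1), congrFun h (Sum.inl 2),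
      congrFun h (Sum.inr 0), congrFun h (Sum.inr 1)⟩
  · rintro ⟨rfl, rfl, rfl, rfl, rfl⟩
    rfl

lemma isAdm_mono {a b c m n : ℕ} :
    IsAdm pF224 (mono a b c m n) ↔ a ≤ 1 ∧ b ≤ 1 ∧ c ≤ 1 := by
  simp [IsAdm, mono, pF224, Fin.forall_fin_succ]

lemma deg_mono (a b c m n : ℕ) : deg (mono a b c m n) = a + b + c + m + n := by
  simp [deg, mono, Fin.sum_univ_succ]
  ring

section Differential

variable {F : Type*} [Field F]

lemma dcoef_F224 (b k l : Fin 3 ⊕ Fin 2) :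
    dcoef F pF224 ordF224 (cF224 F) b k l =
      if b = Sum.inl 2 ∧ k = Sum.inl 0 ∧ l = Sum.inl 1 ∨
        b = Sum.inr 1 ∧ (k = Sum.inl 0 ∨ k = Sum.inl 1) ∧ l = Sum.inr 0 then 1 else 0 := by
  rcases b with b | b <;> rcases k with k | k <;> rcases l with l | l <;>
    fin_cases b <;> fin_cases k <;> fin_cases l <;>
    simp [dcoef, cF224, pF224, ordF224]

lemma dMono_mono {a b c : ℕ} (ha : a ≤ 1) (hb : b ≤ 1) (hc : c ≤ 1) (m n : ℕ) :
    dMono F pF224 ordF224 (cF224 F) (mono a b c m n) =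
      (if a = 0 then Finsupp.single (mono 1 b c (m + 1) (n - 1)) (n : F) else 0) +
      (if b = 0 then Finsupp.single (mono a 1 c (m + 1) (n - 1)) ((-1 : F) ^ a * n) else 0) +
      (if a = 0 ∧ b = 0 ∧ c = 1 then Finsupp.single (mono 1 1 0 m n) 1 else 0) := by
  have tgt_two : tgt (mono a b c m n) (Sum.inl 2) (Sum.inl 0) (Sum.inl 1) =
      mono (a + 1) (b + 1) (c - 1) m n := by
    ext x; rcases x with i | i <;> fin_cases i <;> simp [tgt, eps, mono]
  have tgt_zero : tgt (mono a b c m n) (Sum.inr 1) (Sum.inl 0) (Sum.inr 0) =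
      mono (a + 1) b c (m + 1) (n - 1) := by
    ext x; rcases x with i | i <;> fin_cases i <;> simp [tgt, eps, mono]
  have tgt_one : tgt (mono a b c m n) (Sum.inr 1) (Sum.inl 1) (Sum.inr 0) =
      mono a (b + 1) c (m + 1) (n - 1) := by
    ext x; rcases x with i | i <;> fin_cases i <;> simp [tgt, eps, mono]
  unfold dMono
  simp only [dcoef_F224, Fintype.sum_sum_type, Fin.sum_univ_succ]
  simp [-Finsupp.single_mul, tgt_zero, tgt_one, tgt_two, isAdm_mono]
  simp [-Finsupp.single_mul, sgnProd, Fin.sum_univ_succ, mono_apply, eps, pF224, ordF224]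
  rcases neg_one_pow_eq_or F m with hm | hm <;>
    rcases n with _ | n <;> [skip; rcases neg_one_pow_eq_or F n with hn | hn;
      skip; rcases neg_one_pow_eq_or F n with hn | hn] <;>
    interval_cases a <;> interval_cases b <;> interval_cases c <;>
    simp [-Finsupp.single_mul, pow_add, pow_mul, *] <;> abel

lemma AdmDeg_eq_supported (k : ℕ) :
    AdmDeg F pF224 k = Finsupp.supported F F {μ | IsAdm pF224 μ ∧ deg μ = k} := by
  ext φ
  simp only [AdmDeg, Finsupp.mem_supported, Set.subset_def, Submodule.mem_mk]
  simp

lemma AdmDeg_ext {k : ℕ} {φ ψ : Cochain F (Fin 3 ⊕ Fin 2)} (hφ : φ ∈ AdmDeg F pF224 k)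
    (hψ : ψ ∈ AdmDeg F pF224 k)
    (h : ∀ a b c m n, a ≤ 1 → b ≤ 1 → c ≤ 1 → a + b + c + m + n = k →
      φ (mono a b c m n) = ψ (mono a b c m n)) : φ = ψ := by
  ext μ
  by_cases hμ : IsAdm pF224 μ ∧ deg μ = k
  · rw [eq_mono μ, isAdm_mono, deg_mono] at hμ
    rw [eq_mono μ]
    exact h _ _ _ _ _ hμ.1.1 hμ.1.2.1 hμ.1.2.2 hμ.2
  · rw [not_imp_comm.1 (hφ μ) hμ, not_imp_comm.1 (hψ μ) hμ]

/-- Linear statements about `AdmDeg` need only be checked on monomials. -/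
lemma AdmDeg_induction {k : ℕ} {P : Cochain F (Fin 3 ⊕ Fin 2) → Prop}
    (hmono : ∀ a b c m n, a ≤ 1 → b ≤ 1 → c ≤ 1 → a + b + c + m + n = k →
      P (Finsupp.single (mono a b c m n) 1))
    (hzero : P 0) (hadd : ∀ φ ψ, P φ → P ψ → P (φ + ψ)) (hsmul : ∀ (r : F) φ, P φ → P (r • φ))
    {φ : Cochain F (Fin 3 ⊕ Fin 2)} (hφ : φ ∈ AdmDeg F pF224 k) : P φ := by
  rw [AdmDeg_eq_supported, Finsupp.supported_eq_span_single] at hφ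
  induction hφ using Submodule.span_induction with
  | mem x hx =>
    obtain ⟨μ, hμ, rfl⟩ := hx
    rw [eq_mono μ, Set.mem_ofPred_eq, isAdm_mono, deg_mono] at hμ
    rw [eq_mono μ]
    exact hmono _ _ _ _ _ hμ.1.1 hμ.1.2.1 hμ.1.2.2 hμ.2
  | zero => exact hzero
  | add x y _ _ hx hy => exact hadd x y hx hy
  | smul r x _ hx => exact hsmul r x hx

lemma single_mono_mem {a b c m n k : ℕ} (ha : a ≤ 1) (hb : b ≤ 1) (hc : c ≤ 1)
    (hk : a + b + c + m + n = k) (r : F) :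
    Finsupp.single (mono a b c m n) r ∈ AdmDeg F pF224 k := by
  rw [AdmDeg_eq_supported]
  exact Finsupp.single_mem_supported F r ⟨isAdm_mono.2 ⟨ha, hb, hc⟩, by rw [deg_mono, hk]⟩

lemma d_single (μ : Fin 3 ⊕ Fin 2 → ℕ) :
    d F pF224 ordF224 (cF224 F) (Finsupp.single μ 1) = dMono F pF224 ordF224 (cF224 F) μ := by
  simp [d]

lemma d_mem {k : ℕ} {φ : Cochain F (Fin 3 ⊕ Fin 2)} (hφ : φ ∈ AdmDeg F pF224 k) :
    d F pF224 ordF224 (cF224 F) φ ∈ AdmDeg F pF224 (k + 1) := by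
  refine AdmDeg_induction (P := fun φ => d F pF224 ordF224 (cF224 F) φ ∈ AdmDeg F pF224 (k + 1))
    (fun a b c m n ha hb hc hk => ?_) (by simp)
    (fun φ ψ h h' => by rw [map_add]; exact add_mem h h')
    (fun r φ h => by rw [map_smul]; exact Submodule.smul_mem _ r h) hφ
  rw [d_single, dMono_mono ha hb hc]
  refine add_mem (add_mem ?_ ?_) ?_
  · split_ifs with h
    · rcases n with _ | n
      · simp
      · exact single_mono_mem le_rfl hb hc (by lia) _
    · exact zero_mem _
  · split_ifs with h
    · rcases n with _ | n
      · simp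
      · exact single_mono_mem ha le_rfl hc (by lia) _
    · exact zero_mem _
  · split_ifs with h
    · exact single_mono_mem le_rfl le_rfl zero_le_one (by lia) _
    · exact zero_mem _

/-- The coefficients of a coboundary. -/
lemma d_apply {k : ℕ} {φ : Cochain F (Fin 3 ⊕ Fin 2)} (hφ : φ ∈ AdmDeg F pF224 k) {a b c : ℕ}
    (ha : a ≤ 1) (hb : b ≤ 1) (hc : c ≤ 1) (m n : ℕ) :
    d F pF224 ordF224 (cF224 F) φ (mono a b c m n) =
      (if a = 1 ∧ m ≠ 0 then ((n : F) + 1) * φ (mono 0 b c (m - 1) (n + 1)) else 0) +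
      (if b = 1 ∧ m ≠ 0 then (-1) ^ a * ((n : F) + 1) * φ (mono a 0 c (m - 1) (n + 1)) else 0) +
      (if a = 1 ∧ b = 1 ∧ c = 0 then φ (mono 0 0 1 m n) else 0) := by
  refine AdmDeg_induction (P := fun φ => d F pF224 ordF224 (cF224 F) φ (mono a b c m n) =
      (if a = 1 ∧ m ≠ 0 then ((n : F) + 1) * φ (mono 0 b c (m - 1) (n + 1)) else 0) +
      (if b = 1 ∧ m ≠ 0 then (-1) ^ a * ((n : F) + 1) * φ (mono a 0 c (m - 1) (n + 1)) else 0) +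
      (if a = 1 ∧ b = 1 ∧ c = 0 then φ (mono 0 0 1 m n) else 0))
    (fun a' b' c' m' n' ha' hb' hc' _ => ?_) (by simp)
    (fun φ ψ h h' => ?_) (fun r φ h => ?_) hφ
  · rw [d_single, dMono_mono ha' hb' hc']
    rcases n' with _ | n' <;> rcases m with _ | m <;>
    interval_cases a <;> interval_cases b <;> interval_cases c <;>
    interval_cases a' <;> interval_cases b' <;> interval_cases c' <;>
      simp [-Finsupp.single_mul, Finsupp.single_apply, mono_inj] <;> grind
  · rw [map_add, Finsupp.add_apply, h, h']
    simp only [Finsupp.add_apply]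
    split_ifs <;> ring
  · rw [map_smul, Finsupp.smul_apply, h]
    simp only [Finsupp.smul_apply, smul_eq_mul]
    split_ifs <;> ring

lemma d_d {k : ℕ} {φ : Cochain F (Fin 3 ⊕ Fin 2)} (hφ : φ ∈ AdmDeg F pF224 k) :
    d F pF224 ordF224 (cF224 F) (d F pF224 ordF224 (cF224 F) φ) = 0 := by
  refine AdmDeg_ext (d_mem (d_mem hφ)) (zero_mem _) fun a b c m n ha hb hc _ => ?_
  rw [d_apply (d_mem hφ) ha hb hc, d_apply hφ zero_le_one hb hc, d_apply hφ ha zero_le_one hc,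
    d_apply hφ zero_le_one zero_le_one le_rfl]
  interval_cases a <;> interval_cases b <;> simp
  split_ifs <;> ring

lemma finrank_le_card_of_eval {α : Type*} (W : Submodule F (α →₀ F)) (T : Finset α)
    (h : ∀ w ∈ W, (∀ t ∈ T, w t = 0) → w = 0) : Module.finrank F W ≤ T.card := by
  have hinj : Function.Injective
      ((LinearMap.pi fun t : T => Finsupp.lapply (R := F) (M := F) (t : α)) ∘ₗ W.subtype) := by
    rw [injective_iff_map_eq_zero]
    rintro ⟨w, hw⟩ h0
    exact Subtype.ext (h w hw fun t ht => congrFun h0 ⟨t, ht⟩)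
  simpa using LinearMap.finrank_le_finrank_of_injective hinj

/-- An enumeration of the admissible monomials of degree `k`. -/
def monoIndex (k : ℕ) : Type :=
  Σ s : Fin 2 × Fin 2 × Fin 2, Fin (k + 1 - (s.1 + s.2.1 + s.2.2 : ℕ))

instance (k : ℕ) : Fintype (monoIndex k) := inferInstanceAs (Fintype (Sigma _))

lemma card_monoIndex (k : ℕ) :
    Fintype.card (monoIndex k) = (k + 1) + 3 * k + 3 * (k - 1) + (k - 2) := by
  have h : Fintype.card (monoIndex k) =
      ∑ s : Fin 2 × Fin 2 × Fin 2, (k + 1 - (s.1 + s.2.1 + s.2.2 : ℕ)) := by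
    exact Fintype.card_sigma.trans (sum_congr rfl fun _ _ => Fintype.card_fin _)
  rw [h]
  simp [Fintype.sum_prod_type, Fin.sum_univ_two]
  lia

/-- The admissible monomials of degree `k` are enumerated by `monoIndex k`. -/
def monoEquiv (k : ℕ) : monoIndex k ≃ {μ | IsAdm pF224 μ ∧ deg μ = k} :=
  Equiv.ofBijective
    (fun i => ⟨mono i.1.1 i.1.2.1 i.1.2.2 (k - (i.1.1 + i.1.2.1 + i.1.2.2 : ℕ) - i.2) i.2,
      isAdm_mono.2 ⟨by lia, by lia, by lia⟩, by rw [deg_mono]; lia⟩) <| by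
    constructor
    · rintro ⟨⟨a, b, c⟩, n⟩ ⟨⟨a', b', c'⟩, n'⟩ h
      obtain ⟨ha, hb, hc, -, hn⟩ := mono_inj.1 (congrArg Subtype.val h)
      obtain rfl := Fin.ext ha
      obtain rfl := Fin.ext hb
      obtain rfl := Fin.ext hc
      obtain rfl := Fin.ext hn
      rfl
    · rintro ⟨μ, hμ⟩
      rw [eq_mono μ, Set.mem_ofPred_eq, isAdm_mono, deg_mono] at hμ
      refine ⟨⟨⟨⟨μ (Sum.inl 0), by lia⟩, ⟨μ (Sum.inl 1), by lia⟩, ⟨μ (Sum.inl 2), by lia⟩⟩,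
        ⟨μ (Sum.inr 1), by dsimp only; lia⟩⟩, Subtype.ext ?_⟩
      dsimp only
      conv_rhs => rw [eq_mono μ]
      exact mono_inj.2 ⟨rfl, rfl, rfl, by lia, rfl⟩

/-- Cochains of degree `k` in coordinates. -/
def AdmDegEquiv (k : ℕ) : AdmDeg F pF224 k ≃ₗ[F] (monoIndex k →₀ F) :=
  (LinearEquiv.ofEq _ _ (AdmDeg_eq_supported k)).trans <|
    (Finsupp.supportedEquivFinsupp _).trans (Finsupp.domLCongr (monoEquiv k).symm)

instance (k : ℕ) : FiniteDimensional F (AdmDeg F pF224 k) :=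
  (AdmDegEquiv k).symm.finiteDimensional

lemma finrank_AdmDeg (k : ℕ) :
    Module.finrank F (AdmDeg F pF224 k) = (k + 1) + 3 * k + 3 * (k - 1) + (k - 2) := by
  rw [(AdmDegEquiv k).finrank_eq, Module.finrank_finsupp_self, card_monoIndex]

lemma finrank_Zk_add (k : ℕ) :
    Module.finrank F (Zk F pF224 ordF224 (cF224 F) k) +
      Module.finrank F ((AdmDeg F pF224 k).map (d F pF224 ordF224 (cF224 F))) =
      (k + 1) + 3 * k + 3 * (k - 1) + (k - 2) := by
  have h := LinearMap.finrank_range_add_finrank_ker (K := F)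
    (V := AdmDeg F pF224 k) (V₂ := Cochain F (Fin 3 ⊕ Fin 2))
    ((d F pF224 ordF224 (cF224 F)).domRestrict (AdmDeg F pF224 k))
  rw [LinearMap.range_domRestrict, LinearMap.ker_domRestrict, finrank_AdmDeg, add_comm,
    ← Submodule.finrank_map_subtype_eq, Submodule.map_comap_subtype] at h
  exact h

lemma Hdim_succ (k : ℕ) : Hdim F pF224 ordF224 (cF224 F) (k + 1) =
    Module.finrank F (Zk F pF224 ordF224 (cF224 F) (k + 1)) -
      Module.finrank F ((AdmDeg F pF224 k).map (d F pF224 ordF224 (cF224 F))) := by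
  rw [Hdim, inf_eq_left.2, Bk, Nat.add_sub_cancel]
  rintro _ ⟨φ, hφ, rfl⟩
  exact ⟨d_mem hφ, d_d hφ⟩

section CharZero

variable [CharZero F]

lemma Zk_apply_eq_zero {k : ℕ} {φ : Cochain F (Fin 3 ⊕ Fin 2)}
    (hφ : φ ∈ Zk F pF224 ordF224 (cF224 F) k) {c : ℕ} (hc : c ≤ 1) (m n : ℕ) :
    φ (mono 0 0 c m (n + 1)) = 0 := by
  have h := d_apply hφ.1 le_rfl zero_le_one hc (m + 1) n
  rw [LinearMap.mem_ker.1 hφ.2] at h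
  simpa [Nat.cast_add_one_ne_zero] using h

lemma Zk_apply_eq {k : ℕ} {φ : Cochain F (Fin 3 ⊕ Fin 2)}
    (hφ : φ ∈ Zk F pF224 ordF224 (cF224 F) k) {c : ℕ} (hc : c ≤ 1) (m n : ℕ)
    (h0 : φ (mono 1 0 c m (n + 1)) = 0) (h1 : c = 0 → φ (mono 0 0 1 (m + 1) n) = 0) :
    φ (mono 0 1 c m (n + 1)) = 0 := by
  have h := d_apply hφ.1 le_rfl le_rfl hc (m + 1) n
  rw [LinearMap.mem_ker.1 hφ.2] at h
  rw [if_pos (by simp), if_pos (by simp)] at h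
  have h2 : (if 1 = 1 ∧ 1 = 1 ∧ c = 0 then φ (mono 0 0 1 (m + 1) n) else 0) = 0 := by
    split_ifs with hc0
    · exact h1 hc0.2.2
    · rfl
  rw [h2] at h
  simpa [Nat.cast_add_one_ne_zero, h0] using h

lemma finrank_Zk_le (k : ℕ) :
    Module.finrank F (Zk F pF224 ordF224 (cF224 F) k) ≤
      1 + min k 1 + 2 * min (k - 1) 1 + k + 2 * (k - 1) + (k - 2) := by
  refine (finrank_le_card_of_eval _
    ({mono 0 0 0 k 0} ∪ (range (min k 1)).image (fun _ => mono 0 1 0 (k - 1) 0) ∪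
      (range (min (k - 1) 1)).image (fun _ => mono 0 0 1 (k - 1) 0) ∪
      (range (min (k - 1) 1)).image (fun _ => mono 0 1 1 (k - 2) 0) ∪
      (range k).image (fun n => mono 1 0 0 (k - 1 - n) n) ∪
      (range (k - 1)).image (fun n => mono 1 1 0 (k - 2 - n) n) ∪
      (range (k - 1)).image (fun n => mono 1 0 1 (k - 2 - n) n) ∪
      (range (k - 2)).image (fun n => mono 1 1 1 (k - 3 - n) n))
    fun φ hφ hT => ?_).trans ?_
  · simp only [mem_union, mem_singleton, mem_image, mem_range] at hT
    have h100 (m n : ℕ) (hk : 1 + m + n = k) : φ (mono 1 0 0 m n) = 0 :=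
      hT _ (by simp [mono_inj]; lia)
    have h110 (m n : ℕ) (hk : 2 + m + n = k) : φ (mono 1 1 0 m n) = 0 :=
      hT _ (by simp [mono_inj]; lia)
    have h101 (m n : ℕ) (hk : 2 + m + n = k) : φ (mono 1 0 1 m n) = 0 :=
      hT _ (by simp [mono_inj]; lia)
    have h111 (m n : ℕ) (hk : 3 + m + n = k) : φ (mono 1 1 1 m n) = 0 :=
      hT _ (by simp [mono_inj]; lia)
    have h000 (m n : ℕ) (hk : m + n = k) : φ (mono 0 0 0 m n) = 0 := by
      rcases n with _ | n
      · exact hT _ (by simp [mono_inj]; lia)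
      · exact Zk_apply_eq_zero hφ zero_le_one m n
    have h001 (m n : ℕ) (hk : 1 + m + n = k) : φ (mono 0 0 1 m n) = 0 := by
      rcases n with _ | n
      · rcases m with _ | m
        · have h := d_apply hφ.1 le_rfl le_rfl zero_le_one 0 0
          rw [LinearMap.mem_ker.1 hφ.2] at h
          simpa using h.symm
        · exact hT _ (by simp [mono_inj]; lia)
      · exact Zk_apply_eq_zero hφ le_rfl m n
    have h010 (m n : ℕ) (hk : 1 + m + n = k) : φ (mono 0 1 0 m n) = 0 := by
      rcases n with _ | n
      · exact hT _ (by simp [mono_inj]; lia)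
      · exact Zk_apply_eq hφ zero_le_one m n (h100 _ _ hk) fun _ => h001 _ _ (by lia)
    have h011 (m n : ℕ) (hk : 2 + m + n = k) : φ (mono 0 1 1 m n) = 0 := by
      rcases n with _ | n
      · exact hT _ (by simp [mono_inj]; lia)
      · exact Zk_apply_eq hφ le_rfl m n (h101 _ _ hk) (by simp)
    refine AdmDeg_ext hφ.1 (zero_mem _) fun a b c m n ha hb hc hk => ?_
    rw [Finsupp.zero_apply]
    interval_cases a <;> interval_cases b <;> interval_cases c
    · exact h000 m n (by lia)
    · exact h001 m n (by lia)
    · exact h010 m n (by lia)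
    · exact h011 m n (by lia)
    · exact h100 m n (by lia)
    · exact h101 m n (by lia)
    · exact h110 m n (by lia)
    · exact h111 m n (by lia)
  · refine (card_union_le _ _).trans ?_
    grw [card_union_le, card_union_le, card_union_le, card_union_le, card_union_le, card_union_le]
    grw [card_image_le, card_image_le, card_image_le, card_image_le, card_image_le, card_image_le,
      card_image_le]
    simp only [card_range, card_singleton]
    lia

lemma finrank_map_d_le (k : ℕ) :
    Module.finrank F ((AdmDeg F pF224 k).map (d F pF224 ordF224 (cF224 F))) ≤
      k + 2 * (k - 1) + (k - 2) + if k = 1 then 1 else 0 := by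
  refine (finrank_le_card_of_eval _
    ((range k).image (fun n => mono 1 0 0 (k - n) n) ∪
      (range (k - 1)).image (fun n => mono 1 1 0 (k - 1 - n) n) ∪
      (range (k - 1)).image (fun n => mono 1 0 1 (k - 1 - n) n) ∪
      (range (k - 2)).image (fun n => mono 1 1 1 (k - 2 - n) n) ∪
      if k = 1 then {mono 1 1 0 0 0} else ∅) ?_).trans ?_
  · rintro _ ⟨φ, hφ, rfl⟩ hT
    simp only [mem_union, mem_image, mem_range] at hT
    have hd {a b c : ℕ} (ha : a ≤ 1) (hb : b ≤ 1) (hc : c ≤ 1) (m n : ℕ) :=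
      d_apply hφ ha hb hc m n
    set ψ := d F pF224 ordF224 (cF224 F) φ
    have h10 (c m n : ℕ) (hc : c ≤ 1) (hk : c + m + n = k) : ψ (mono 1 0 c m n) = 0 := by
      rcases m with _ | m
      · simp [hd le_rfl zero_le_one hc]
      · interval_cases c <;> exact hT _ (by simp [mono_inj]; lia)
    have h01 (c m n : ℕ) (hc : c ≤ 1) (hk : c + m + n = k) : ψ (mono 0 1 c m n) = 0 := by
      rw [← h10 c m n hc hk, hd le_rfl zero_le_one hc, hd zero_le_one le_rfl hc]
      simp
    have h110 (m n : ℕ) (hk : 1 + m + n = k) : ψ (mono 1 1 0 m n) = 0 := by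
      rcases m with _ | m
      · rcases n with _ | n
        · exact hT _ (by rw [if_pos (by lia)]; simp)
        · have h := h10 1 1 n le_rfl (by lia)
          rw [hd le_rfl zero_le_one le_rfl] at h
          simpa [hd le_rfl le_rfl zero_le_one, Nat.cast_add_one_ne_zero] using h
      · exact hT _ (by simp [mono_inj]; lia)
    have h111 (m n : ℕ) (hk : 2 + m + n = k) : ψ (mono 1 1 1 m n) = 0 := by
      rcases m with _ | m
      · simp [hd le_rfl le_rfl le_rfl]
      · exact hT _ (by simp [mono_inj]; lia)
    refine AdmDeg_ext (d_mem hφ) (zero_mem _) fun a b c m n ha hb hc hk => ?_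
    rw [Finsupp.zero_apply]
    interval_cases a <;> interval_cases b
    · simp [hd zero_le_one zero_le_one hc]
    · exact h01 c m n hc (by lia)
    · exact h10 c m n hc (by lia)
    · interval_cases c
      · exact h110 m n (by lia)
      · exact h111 m n (by lia)
  · grw [card_union_le, card_union_le, card_union_le, card_union_le]
    grw [card_image_le, card_image_le, card_image_le, card_image_le]
    simp only [card_range]
    split_ifs <;> simp <;> lia

lemma finrank_Zk (k : ℕ) :
    Module.finrank F (Zk F pF224 ordF224 (cF224 F) k) =
      1 + min k 1 + 2 * min (k - 1) 1 + k + 2 * (k - 1) + (k - 2) := by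
  have h1 := finrank_Zk_add (F := F) k
  have h2 := finrank_Zk_le (F := F) k
  have h3 := finrank_map_d_le (F := F) k
  split_ifs at h3 <;> lia

lemma finrank_map_d (k : ℕ) :
    Module.finrank F ((AdmDeg F pF224 k).map (d F pF224 ordF224 (cF224 F))) =
      k + 2 * (k - 1) + (k - 2) + if k = 1 then 1 else 0 := by
  have h1 := finrank_Zk_add (F := F) k
  have h2 := finrank_Zk (F := F) k
  split_ifs <;> lia

lemma Hdim_zero : Hdim F pF224 ordF224 (cF224 F) 0 = 1 := by
  have h : (AdmDeg F pF224 0).map (d F pF224 ordF224 (cF224 F)) = ⊥ :=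
    Submodule.finrank_eq_zero.1 (finrank_map_d 0)
  rw [Hdim, finrank_Zk, Bk, h, bot_inf_eq, finrank_bot]
  simp

end CharZero

end Differential

/-- For the filiform Lie superalgebra `F_{2,2}⁴` (nonzero brackets `[X₀,X₁] = X₂`, `[X₀,Y₁] = [X₁,Y₁] = Y₂`) over an algebraically closed field of characteristic zero, the Betti numbers are `dim H^0 = 1`, `dim H^1 = 3`, `dim H^2 = 6` and `dim H^k = 8` for all `k ≥ 3`. -/
theorem betti_F224
    (F : Type*) [Field F] [IsAlgClosed F] [CharZero F] :
    Hdim F pF224 ordF224 (cF224 F) 0 = 1 ∧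
    Hdim F pF224 ordF224 (cF224 F) 1 = 3 ∧
    Hdim F pF224 ordF224 (cF224 F) 2 = 6 ∧
    (∀ k : ℕ, 3 ≤ k → Hdim F pF224 ordF224 (cF224 F) k = 8) := by
  refine ⟨Hdim_zero, ?_, ?_, fun k hk => ?_⟩
  · rw [Hdim_succ, finrank_Zk, finrank_map_d]
    simp
  · rw [Hdim_succ, finrank_Zk, finrank_map_d]
    simp
  · obtain ⟨k, rfl⟩ := Nat.exists_eq_add_of_le' hk
    rw [Hdim_succ, finrank_Zk, finrank_map_d, if_neg (by lia)]
    lia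

end Paper
end
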